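/- Let F ∈ ℂ[x,y,z] be a three-term form of degree d ≥ 3 with power matrix P = (p_ij), and assume F is irreducible in ℂ[x,y,z] and smooth (the only common zero in ℂ³ of ∂F/∂x, ∂F/∂y, ∂F/∂z is (0,0,0)). Then the determinant of P, computed as an integer, is nonzero. -/

import Mathlib

open MvPolynomial

/-- The gradient of a monomial whose degree exceeds its `j`-th exponent by at least two vanishes
at the `j`-th coordinate point. -/
theorem eval_single_pderiv_ternary_monomial {R : Type*} [CommSemiring R] (a : Fin 3 → ℕ)
    (j k : Fin 3) (h : a j + 2 ≤ a 0 + a 1 + a 2) :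
    eval (Pi.single j (1 : R))
      (pderiv k (X 0 ^ a 0 * X 1 ^ a 1 * X 2 ^ a 2 : MvPolynomial (Fin 3) R)) = 0 := by
  fin_cases j <;> fin_cases k <;>
    simp [pderiv_X, Derivation.leibniz_pow, zero_pow_eq] at h ⊢ <;> grind

/-- A ternary form of degree `d` with three terms and no singular point at the `j`-th coordinate
point has a term whose `j`-th exponent is at least `d - 1`. -/
theorem exists_le_exponent_add_one_of_smooth {R : Type*} [CommSemiring R] [Nontrivial R] {d : ℕ}
    {p : Fin 3 → Fin 3 → ℕ} (A : Fin 3 → R) (hdeg : ∀ i, p i 0 + p i 1 + p i 2 = d)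
    (hsmooth : ∀ v : Fin 3 → R, (∀ k, eval v (pderiv k
      (C (A 0) * (X 0 ^ p 0 0 * X 1 ^ p 0 1 * X 2 ^ p 0 2)
        + C (A 1) * (X 0 ^ p 1 0 * X 1 ^ p 1 1 * X 2 ^ p 1 2)
        + C (A 2) * (X 0 ^ p 2 0 * X 1 ^ p 2 1 * X 2 ^ p 2 2))) = 0) → v = 0) (j : Fin 3) :
    ∃ i, d ≤ p i j + 1 := by
  by_contra! h
  have hv := hsmooth (Pi.single j 1) fun k => by
    have hz i := eval_single_pderiv_ternary_monomial (R := R) (p i) j k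
      (by have := h i; have := hdeg i; omega)
    simp only [map_add, pderiv_C_mul, map_mul, hz, mul_zero, add_zero]
  simpa using congrFun hv j

/-- A square matrix of size three with row sums `d ≥ 3` is nondegenerate if each column has an
entry at least `d - 1`. -/
theorem det_ne_zero_of_forall_exists_le_add_one {d : ℕ} (hd : 3 ≤ d) {p : Fin 3 → Fin 3 → ℕ}
    (hdeg : ∀ i, p i 0 + p i 1 + p i 2 = d) (h : ∀ j, ∃ i, d ≤ p i j + 1) :
    (Matrix.of fun i j : Fin 3 => (p i j : ℤ)).det ≠ 0 := by
  choose f hf using h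
  have hrow (j k : Fin 3) (hjk : j ≠ k) : p (f j) j + p (f j) k ≤ d := by
    have := hdeg (f j)
    fin_cases j <;> fin_cases k <;> simp at hjk ⊢ <;> simp at this <;> omega
  have hinj : Function.Injective f := by
    intro j k hjk
    by_contra hne
    have := hrow j k hne
    have := hf j
    have := hf k
    rw [← hjk] at this
    omega
  let σ : Equiv.Perm (Fin 3) := Equiv.ofBijective f (Finite.injective_iff_bijective.mp hinj)
  let M : Matrix (Fin 3) (Fin 3) ℤ := Matrix.of fun i j => (p i j : ℤ)
  have hdom : ((M.submatrix σ id).map (Int.castRingHom ℝ)).det ≠ 0 := by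
    refine det_ne_zero_of_sum_row_lt_diag fun k => ?_
    have hsum : ∑ j ∈ Finset.univ.erase k, p (f k) j < p (f k) k := by
      have h1 := Finset.add_sum_erase Finset.univ (p (f k)) (Finset.mem_univ k)
      have h2 := hdeg (f k)
      have h3 := hf k
      rw [Fin.sum_univ_three] at h1
      omega
    simpa [M, σ] using (by exact_mod_cast hsum :
      ∑ j ∈ Finset.univ.erase k, (p (f k) j : ℝ) < p (f k) k)
  intro hM
  refine hdom ?_
  rw [← RingHom.mapMatrix_apply, ← RingHom.map_det, Matrix.det_permute, hM, mul_zero, map_zero]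

/-- The power matrix of an irreducible smooth three-term form of degree
`d ≥ 3` has nonzero (integer) determinant. -/
theorem three_term_power_matrix_nondegenerate
    (d : ℕ) (hd : 3 ≤ d)
    (p : Fin 3 → Fin 3 → ℕ) (A : Fin 3 → ℂ) (hA : ∀ i, A i ≠ 0)
    (hdist : Function.Injective fun i : Fin 3 => (p i 0, p i 1, p i 2))
    (hdeg : ∀ i, p i 0 + p i 1 + p i 2 = d)
    (F : MvPolynomial (Fin 3) ℂ)
    (hF : F = C (A 0) * (X 0 ^ p 0 0 * X 1 ^ p 0 1 * X 2 ^ p 0 2)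
            + C (A 1) * (X 0 ^ p 1 0 * X 1 ^ p 1 1 * X 2 ^ p 1 2)
            + C (A 2) * (X 0 ^ p 2 0 * X 1 ^ p 2 1 * X 2 ^ p 2 2))
    (hirr : Irreducible F)
    (hsmooth : ∀ v : Fin 3 → ℂ, (∀ i, eval v (pderiv i F) = 0) → v = 0) :
    (Matrix.of fun i j : Fin 3 => (p i j : ℤ)).det ≠ 0 := by
  subst hF
  exact det_ne_zero_of_forall_exists_le_add_one hd hdeg
    (exists_le_exponent_add_one_of_smooth A hdeg hsmooth)
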